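/- arXiv:1812.06896 — 4 statements merged into one kernel-verified Lean document; each statement's English description precedes it below -/
import Mathlib

section
/- Let κ > 1 be a real number and set μ = (κ−1)/(κ+1). Then 2/μ² − 1 − (2/μ²)·√(1−μ²) = ( (√κ − 1)/(√κ + 1) )². -/
/-- For `κ > 1` and `μ = (κ−1)/(κ+1)`, the optimal history coefficient
`2/μ² − 1 − (2/μ²)√(1−μ²)` equals the square of the optimal convergence factor
`(√κ − 1)/(√κ + 1)`. -/
theorem optimal_c1_in_terms_of_kappa (κ : ℝ) (hκ : 1 < κ) (μ : ℝ)
    (hμ : μ = (κ - 1) / (κ + 1)) :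
    2 / μ ^ 2 - 1 - (2 / μ ^ 2) * Real.sqrt (1 - μ ^ 2)
      = ((Real.sqrt κ - 1) / (Real.sqrt κ + 1)) ^ 2 := by
  obtain ⟨s, hs, rfl⟩ : ∃ s : ℝ, 1 < s ∧ κ = s ^ 2 :=
    ⟨√κ, Real.lt_sqrt_of_sq_lt (by simpa using hκ), (Real.sq_sqrt (by linarith)).symm⟩
  have hs_sub : s - 1 ≠ 0 := (sub_pos.2 hs).ne'
  have hs_add : s + 1 ≠ 0 := by positivity
  have hs_sq : s ^ 2 + 1 ≠ 0 := by positivity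
  have hμ' : μ = (s - 1) * (s + 1) / (s ^ 2 + 1) := by rw [hμ]; ring
  have hsqrt : √(1 - μ ^ 2) = 2 * s / (s ^ 2 + 1) := by
    rw [← Real.sqrt_sq (show 0 ≤ 2 * s / (s ^ 2 + 1) by positivity), hμ']
    congr 1
    field_simp
    ring
  rw [hsqrt, Real.sqrt_sq (by linarith), hμ']
  field_simp
  ring
end

section
/- Let A be an N×N real symmetric positive-definite matrix with orthonormal eigenvectors w₁,…,w_N and corresponding eigenvalues η₁,…,η_N. Let S ⊆ {1,…,N} be nonempty, let P be the N×|S| matrix whose columns are the eigenvectors (w_i)_{i∈S}, and set A_H = Pᵀ·A·P. For α ∈ (0,1] define W_α = (α·I + (1−α)·P·A_H⁻¹·Pᵀ)·A. Then for every i: W_α·w_i = (α·η_i + 1 − α)·w_i if i ∈ S, and W_α·w_i = α·η_i·w_i if i ∉ S. -/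
open Matrix

/-- An eigenvalue of a positive-definite matrix with a nonzero eigenvector is nonzero. -/
theorem Matrix.PosDef.eigenvalue_ne_zero {n : Type*} [Fintype n] [DecidableEq n]
    {A : Matrix n n ℝ} (hA : A.PosDef) {v : n → ℝ} (hv : v ≠ 0) {c : ℝ}
    (h : A *ᵥ v = c • v) : c ≠ 0 := by
  rintro rfl
  rw [zero_smul] at h
  exact hv (Matrix.eq_zero_of_mulVec_eq_zero hA.det_pos.ne' h)

/-- Eigenvalue computation in Lemma 3.6: when the columns of the prolongation `P` are
orthonormal eigenvectors `(w_i)_{i∈S}` of the SPD matrix `A` and `A_H = PᵀAP`, the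
matrix `W_α = (αI + (1−α) P A_H⁻¹ Pᵀ) A` satisfies `W_α w_i = (α η_i + 1 − α) w_i`
for `i ∈ S` and `W_α w_i = α η_i w_i` for `i ∉ S`. -/
theorem Walpha_eigenvectors {N : ℕ}
    (A : Matrix (Fin N) (Fin N) ℝ) (hA : A.PosDef)
    (w : Fin N → Fin N → ℝ) (η : Fin N → ℝ)
    (horth : ∀ i j, w i ⬝ᵥ w j = if i = j then (1 : ℝ) else 0)
    (heig : ∀ i, A *ᵥ w i = η i • w i)
    (S : Finset (Fin N)) (hS : S.Nonempty)
    (P : Matrix (Fin N) {i // i ∈ S} ℝ)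
    (hP : ∀ (n : Fin N) (j : {i // i ∈ S}), P n j = w j.val n)
    (α : ℝ) (hα : α ∈ Set.Ioc (0 : ℝ) 1) :
    ∀ i : Fin N,
      (i ∈ S →
        ((α • (1 : Matrix (Fin N) (Fin N) ℝ)
          + (1 - α) • (P * (Pᵀ * A * P)⁻¹ * Pᵀ)) * A) *ᵥ w i
          = (α * η i + 1 - α) • w i) ∧
      (i ∉ S →
        ((α • (1 : Matrix (Fin N) (Fin N) ℝ)
          + (1 - α) • (P * (Pᵀ * A * P)⁻¹ * Pᵀ)) * A) *ᵥ w i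
          = (α * η i) • w i) := by
  have hη : ∀ i, η i ≠ 0 := fun i => by
    refine hA.eigenvalue_ne_zero (fun h => ?_) (heig i)
    simpa [h] using horth i i
  have hPcol : ∀ j : {i // i ∈ S}, P.col j = w j := fun j => funext fun n => hP n j
  have hPw : ∀ i, Pᵀ *ᵥ w i = fun j : {i // i ∈ S} => if (j : Fin N) = i then (1 : ℝ) else 0 := by
    intro i
    ext j
    rw [← horth, ← hPcol]
    rfl
  have hAH : Pᵀ * A * P = diagonal fun j : {i // i ∈ S} => η j := by
    refine ext_of_mulVec_single fun j => ?_
    rw [Matrix.mul_assoc, ← mulVec_mulVec, ← mulVec_mulVec, mulVec_single_one, hPcol, heig,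
      mulVec_smul, hPw, diagonal_mulVec_single]
    ext k
    by_cases hkj : k = j <;> simp [hkj, Subtype.ext_iff.symm]
  have hinv : (Pᵀ * A * P)⁻¹ = diagonal fun j : {i // i ∈ S} => (η j)⁻¹ := by
    rw [hAH]
    refine inv_eq_right_inv ?_
    rw [diagonal_mul_diagonal, ← diagonal_one]
    exact congrArg _ (funext fun j => mul_inv_cancel₀ (hη j))
  intro i
  rw [hinv, ← mulVec_mulVec, heig, mulVec_smul, add_mulVec, smul_mulVec, one_mulVec,
    smul_mulVec, ← mulVec_mulVec, ← mulVec_mulVec, hPw]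
  refine ⟨fun hi => ?_, fun hi => ?_⟩
  · have hsingle : (fun j : {i // i ∈ S} => if (j : Fin N) = i then (1 : ℝ) else 0)
        = Pi.single ⟨i, hi⟩ 1 := by
      ext j
      simp [Pi.single_apply, Subtype.ext_iff]
    rw [hsingle, diagonal_mulVec_single, mul_one, mulVec_single, hPcol]
    ext n
    have := hη i
    simp
    field_simp
    ring
  · have hzero : (fun j : {i // i ∈ S} => if (j : Fin N) = i then (1 : ℝ) else 0) = 0 := by
      ext j
      have hji : (j : Fin N) ≠ i := ne_of_mem_of_not_mem j.2 hi
      simp [hji]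
    rw [hzero, mulVec_zero, mulVec_zero, smul_zero, add_zero, smul_smul, mul_comm]
end

section
/- Let A be an N×N real symmetric positive-definite matrix with orthonormal eigenvectors w₁,…,w_N and eigenvalues η₁,…,η_N, let S ⊆ {1,…,N} be nonempty with complement also nonempty, let P be the matrix whose columns are (w_i)_{i∈S}, A_H = Pᵀ·A·P, and for α ∈ (0,1] let W_α = (α·I + (1−α)·P·A_H⁻¹·Pᵀ)·A. Set η_fmax = max_{i∉S} η_i, η_fmin = min_{i∉S} η_i, η_cmax = max_{i∈S} η_i, η_cmin = min_{i∈S} η_i. Then the ratio of the largest to the smallest eigenvalue of W_α equals κ = max(α·η_fmax, α·η_cmax + 1 − α) / min(α·η_fmin, α·η_cmin + 1 − α). -/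
open Matrix

/-- The eigenvalues of a matrix having an orthonormal family of `N` eigenvectors are exactly the
eigenvalues attached to this family. -/
theorem setOf_eigenvalue_eq_range {n : Type*} [Fintype n] [DecidableEq n]
    {M : Matrix n n ℝ} {w : n → n → ℝ} {μ : n → ℝ}
    (horth : ∀ i j, w i ⬝ᵥ w j = if i = j then (1 : ℝ) else 0)
    (heig : ∀ i, M *ᵥ w i = μ i • w i) :
    {lam : ℝ | ∃ v : n → ℝ, v ≠ 0 ∧ M *ᵥ v = lam • v} = Set.range μ := by
  have hQ : of w * (of w)ᵀ = 1 := by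
    ext i j
    rw [one_apply]
    exact horth i j
  have hQ' : (of w)ᵀ * of w = 1 := mul_eq_one_comm.mp hQ
  have hMQ : M * (of w)ᵀ = (of w)ᵀ * diagonal μ := by
    ext k i
    rw [mul_diagonal]
    exact (congrFun (heig i) k).trans (mul_comm _ _)
  have hQM : of w * M = diagonal μ * of w := by
    calc of w * M = of w * (M * (of w)ᵀ) * of w := by
          rw [Matrix.mul_assoc, Matrix.mul_assoc, hQ', Matrix.mul_one]
      _ = diagonal μ * of w := by rw [hMQ, ← Matrix.mul_assoc, hQ, Matrix.one_mul]
  ext lam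
  constructor
  · rintro ⟨v, hv, hMv⟩
    have hne : of w *ᵥ v ≠ 0 := by
      intro h
      apply hv
      rw [← one_mulVec v, ← hQ', ← mulVec_mulVec, h, mulVec_zero]
    obtain ⟨i, hi⟩ := Function.ne_iff.mp hne
    refine ⟨i, mul_right_cancel₀ hi ?_⟩
    have h : diagonal μ *ᵥ (of w *ᵥ v) = lam • (of w *ᵥ v) := by
      rw [mulVec_mulVec, ← hQM, ← mulVec_mulVec, hMv, mulVec_smul]
    simpa [mulVec_diagonal] using congrFun h i
  · rintro ⟨i, rfl⟩
    refine ⟨w i, fun h => ?_, heig i⟩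
    simpa [h] using horth i i

/-- Orthonormal eigenvectors of `A` are eigenvectors of `(αI + (1−α) P (PᵀAP)⁻¹ Pᵀ) A` when the
columns of `P` are among them. -/
theorem coarse_correction_mulVec_eigenvector {n : Type*} [Fintype n] [DecidableEq n]
    {A : Matrix n n ℝ} {w : n → n → ℝ} {η : n → ℝ}
    (horth : ∀ i j, w i ⬝ᵥ w j = if i = j then (1 : ℝ) else 0)
    (heig : ∀ i, A *ᵥ w i = η i • w i) (hη : ∀ i, η i ≠ 0)
    {S : Finset n} {P : Matrix n {i // i ∈ S} ℝ}
    (hP : ∀ (k : n) (j : {i // i ∈ S}), P k j = w j.val k) (α : ℝ) (i : n) :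
    ((α • (1 : Matrix n n ℝ) + (1 - α) • (P * (Pᵀ * A * P)⁻¹ * Pᵀ)) * A) *ᵥ w i =
      (if i ∈ S then α * η i + 1 - α else α * η i) • w i := by
  have hPP : Pᵀ * P = 1 := by
    ext j k
    simp only [mul_apply, transpose_apply, hP, one_apply, Subtype.ext_iff]
    exact horth j k
  have hAP : A * P = P * diagonal (fun j : {i // i ∈ S} => η j) := by
    ext k j
    rw [mul_diagonal, mul_apply]
    simp only [hP]
    exact (congrFun (heig j) k).trans (mul_comm _ _)
  have hinv : (Pᵀ * A * P)⁻¹ = diagonal (fun j : {i // i ∈ S} => (η j)⁻¹) := by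
    apply inv_eq_right_inv
    rw [Matrix.mul_assoc Pᵀ, hAP, ← Matrix.mul_assoc, hPP, Matrix.one_mul, diagonal_mul_diagonal]
    simp [hη]
  rw [hinv, ← mulVec_mulVec, heig, mulVec_smul, add_mulVec, smul_mulVec, smul_mulVec, one_mulVec]
  split_ifs with hi
  · have hw : w i = P *ᵥ Pi.single ⟨i, hi⟩ 1 := by
      ext k
      simp [hP]
    have hproj : (P * diagonal (fun j : {i // i ∈ S} => (η j)⁻¹) * Pᵀ) *ᵥ w i
        = (η i)⁻¹ • w i := by
      rw [hw, mulVec_mulVec, Matrix.mul_assoc, hPP, Matrix.mul_one, ← mulVec_mulVec,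
        diagonal_mulVec_single, mul_one, ← mulVec_smul, ← Pi.single_smul, smul_eq_mul, mul_one]
    rw [hproj, smul_smul, ← add_smul, smul_smul]
    congr 1
    field_simp [hη i]
    ring
  · have hw : Pᵀ *ᵥ w i = 0 := by
      ext j
      have hne : (j : n) ≠ i := fun h => hi (h ▸ j.2)
      simpa [mulVec, dotProduct, hP, hne] using horth j i
    rw [← mulVec_mulVec, hw, mulVec_zero, smul_zero, add_zero, smul_smul, mul_comm]

/-- Lemma 3.6: with the prolongation columns being orthonormal eigenvectors of the SPD
matrix `A`, the condition number (ratio of largest to smallest eigenvalue) of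
`W_α = (αI + (1−α) P (PᵀAP)⁻¹ Pᵀ) A` equals
`max(α η_fmax, α η_cmax + 1 − α) / min(α η_fmin, α η_cmin + 1 − α)`. -/
theorem Walpha_condition_number {N : ℕ}
    (A : Matrix (Fin N) (Fin N) ℝ) (hA : A.PosDef)
    (w : Fin N → Fin N → ℝ) (η : Fin N → ℝ)
    (horth : ∀ i j, w i ⬝ᵥ w j = if i = j then (1 : ℝ) else 0)
    (heig : ∀ i, A *ᵥ w i = η i • w i)
    (S : Finset (Fin N)) (hS : S.Nonempty) (hSc : Sᶜ.Nonempty)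
    (P : Matrix (Fin N) {i // i ∈ S} ℝ)
    (hP : ∀ (n : Fin N) (j : {i // i ∈ S}), P n j = w j.val n)
    (α : ℝ) (hα : α ∈ Set.Ioc (0 : ℝ) 1) :
    sSup {lam : ℝ | ∃ v : Fin N → ℝ, v ≠ 0 ∧
        ((α • (1 : Matrix (Fin N) (Fin N) ℝ)
          + (1 - α) • (P * (Pᵀ * A * P)⁻¹ * Pᵀ)) * A) *ᵥ v = lam • v}
      / sInf {lam : ℝ | ∃ v : Fin N → ℝ, v ≠ 0 ∧
        ((α • (1 : Matrix (Fin N) (Fin N) ℝ)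
          + (1 - α) • (P * (Pᵀ * A * P)⁻¹ * Pᵀ)) * A) *ᵥ v = lam • v}
      = max (α * Sᶜ.sup' hSc η) (α * S.sup' hS η + 1 - α)
        / min (α * Sᶜ.inf' hSc η) (α * S.inf' hS η + 1 - α) := by
  obtain ⟨hα0, -⟩ := hα
  have hη : ∀ i, η i ≠ 0 := by
    intro i hi
    have hw : w i ≠ 0 := fun h => by simpa [h] using horth i i
    have h := hA.dotProduct_mulVec_pos hw
    simp [heig, hi] at h
  rw [setOf_eigenvalue_eq_range horth
    (coarse_correction_mulVec_eigenvector horth heig hη hP α)]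
  congr 1
  · apply IsGreatest.csSup_eq
    constructor
    · rcases max_choice (α * Sᶜ.sup' hSc η) (α * S.sup' hS η + 1 - α) with h | h <;> rw [h]
      · obtain ⟨i, hi, h⟩ := Sᶜ.exists_mem_eq_sup' hSc η
        exact ⟨i, by simp [h, Finset.mem_compl.mp hi]⟩
      · obtain ⟨i, hi, h⟩ := S.exists_mem_eq_sup' hS η
        exact ⟨i, by simp [h, hi]⟩
    · rintro _ ⟨i, rfl⟩
      dsimp only
      split_ifs with hi
      · have := S.le_sup' η hi
        exact le_max_of_le_right (by gcongr)
      · have := Sᶜ.le_sup' η (Finset.mem_compl.mpr hi)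
        exact le_max_of_le_left (by gcongr)
  · apply IsLeast.csInf_eq
    constructor
    · rcases min_choice (α * Sᶜ.inf' hSc η) (α * S.inf' hS η + 1 - α) with h | h <;> rw [h]
      · obtain ⟨i, hi, h⟩ := Sᶜ.exists_mem_eq_inf' hSc η
        exact ⟨i, by simp [h, Finset.mem_compl.mp hi]⟩
      · obtain ⟨i, hi, h⟩ := S.exists_mem_eq_inf' hS η
        exact ⟨i, by simp [h, hi]⟩
    · rintro _ ⟨i, rfl⟩
      dsimp only
      split_ifs with hi
      · have := S.inf'_le η hi
        exact min_le_of_right_le (by gcongr)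
      · have := Sᶜ.inf'_le η (Finset.mem_compl.mpr hi)
        exact min_le_of_left_le (by gcongr)
end

section
/- Let η_fmin, η_fmax, η_cmin, η_cmax be positive reals with η_fmin ≤ η_fmax, η_cmin ≤ η_cmax, η_cmin ≤ η_fmin, and η_cmax ≤ η_fmax. For α ∈ (0,1] define κ(α) = max(α·η_fmax, α·η_cmax + 1 − α) / min(α·η_fmin, α·η_cmin + 1 − α). Then α_opt = 1/(1 + η_fmin − η_cmin) lies in (0,1], minimizes κ over (0,1] (κ(α_opt) ≤ κ(α) for all α ∈ (0,1]), and κ(α_opt) = η_fmax/η_fmin if η_fmax − η_fmin ≥ η_cmax − η_cmin, while κ(α_opt) = 1 + (η_cmax − η_cmin)/η_fmin otherwise. -/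
/-- The condition number at the optimal `α`, where the two arguments of the minimum coincide. -/
theorem max_div_min_at_opt {a b c d : ℝ} (hD : 0 < 1 + a - c) :
    max ((1 / (1 + a - c)) * b) ((1 / (1 + a - c)) * d + 1 - 1 / (1 + a - c))
        / min ((1 / (1 + a - c)) * a) ((1 / (1 + a - c)) * c + 1 - 1 / (1 + a - c))
      = max b (d + a - c) / a := by
  have hmax : (1 / (1 + a - c)) * d + 1 - 1 / (1 + a - c)
      = (1 / (1 + a - c)) * (d + a - c) := by
    field_simp
    ring
  have hmin : (1 / (1 + a - c)) * c + 1 - 1 / (1 + a - c) = (1 / (1 + a - c)) * a := by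
    field_simp
    ring
  have hpos : 0 < 1 / (1 + a - c) := one_div_pos.mpr hD
  rw [hmax, hmin, min_self, ← mul_max_of_nonneg _ _ hpos.le, mul_div_mul_left _ _ hpos.ne']

/-- The optimal condition number is a lower bound for the condition number at every `α`. -/
theorem max_div_le_max_div_min {a b c d α : ℝ} (ha : 0 < a) (hb : 0 ≤ b) (hc : 0 < c)
    (hcd : c ≤ d) (hα : α ∈ Set.Ioc (0 : ℝ) 1) :
    max b (d + a - c) / a ≤ max (α * b) (α * d + 1 - α) / min (α * a) (α * c + 1 - α) := by
  obtain ⟨hα0, hα1⟩ := hα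
  have hm : 0 < min (α * a) (α * c + 1 - α) :=
    lt_min (by positivity) (by linarith [mul_pos hα0 hc])
  have hm₁ := min_le_left (α * a) (α * c + 1 - α)
  have hm₂ := min_le_right (α * a) (α * c + 1 - α)
  have hM₁ := le_max_left (α * b) (α * d + 1 - α)
  have hM₂ := le_max_right (α * b) (α * d + 1 - α)
  generalize min (α * a) (α * c + 1 - α) = m at *
  generalize max (α * b) (α * d + 1 - α) = M at *
  rw [div_le_div_iff₀ ha hm, max_mul_of_nonneg _ _ hm.le]
  apply max_le
  · linarith [mul_le_mul_of_nonneg_left hm₁ hb, mul_le_mul_of_nonneg_right hM₁ ha.le]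
  · have h : m + α * (d - c) ≤ M := by linarith
    linarith [mul_le_mul_of_nonneg_right h ha.le,
      mul_le_mul_of_nonneg_right hm₁ (sub_nonneg.mpr hcd)]

/-- Theorem 3.7: `α_opt = 1/(1 + η_fmin − η_cmin)` minimizes the condition number
`κ(α) = max(α η_fmax, α η_cmax + 1 − α)/min(α η_fmin, α η_cmin + 1 − α)` over `(0,1]`,
with the stated optimal value. -/
theorem optimal_alpha (ηfmin ηfmax ηcmin ηcmax : ℝ)
    (h1 : 0 < ηfmin) (h2 : 0 < ηfmax) (h3 : 0 < ηcmin) (h4 : 0 < ηcmax)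
    (h5 : ηfmin ≤ ηfmax) (h6 : ηcmin ≤ ηcmax) (h7 : ηcmin ≤ ηfmin) (h8 : ηcmax ≤ ηfmax) :
    (1 / (1 + ηfmin - ηcmin)) ∈ Set.Ioc (0 : ℝ) 1 ∧
    (∀ α ∈ Set.Ioc (0 : ℝ) 1,
      max ((1 / (1 + ηfmin - ηcmin)) * ηfmax)
          ((1 / (1 + ηfmin - ηcmin)) * ηcmax + 1 - 1 / (1 + ηfmin - ηcmin))
        / min ((1 / (1 + ηfmin - ηcmin)) * ηfmin)
              ((1 / (1 + ηfmin - ηcmin)) * ηcmin + 1 - 1 / (1 + ηfmin - ηcmin))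
      ≤ max (α * ηfmax) (α * ηcmax + 1 - α) / min (α * ηfmin) (α * ηcmin + 1 - α)) ∧
    (ηfmax - ηfmin ≥ ηcmax - ηcmin →
      max ((1 / (1 + ηfmin - ηcmin)) * ηfmax)
          ((1 / (1 + ηfmin - ηcmin)) * ηcmax + 1 - 1 / (1 + ηfmin - ηcmin))
        / min ((1 / (1 + ηfmin - ηcmin)) * ηfmin)
              ((1 / (1 + ηfmin - ηcmin)) * ηcmin + 1 - 1 / (1 + ηfmin - ηcmin))
      = ηfmax / ηfmin) ∧
    (ηfmax - ηfmin < ηcmax - ηcmin →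
      max ((1 / (1 + ηfmin - ηcmin)) * ηfmax)
          ((1 / (1 + ηfmin - ηcmin)) * ηcmax + 1 - 1 / (1 + ηfmin - ηcmin))
        / min ((1 / (1 + ηfmin - ηcmin)) * ηfmin)
              ((1 / (1 + ηfmin - ηcmin)) * ηcmin + 1 - 1 / (1 + ηfmin - ηcmin))
      = 1 + (ηcmax - ηcmin) / ηfmin) := by
  have hD : 1 ≤ 1 + ηfmin - ηcmin := by linarith
  have hD0 : 0 < 1 + ηfmin - ηcmin := by linarith
  rw [max_div_min_at_opt hD0]
  refine ⟨⟨one_div_pos.mpr hD0, div_le_one_of_le₀ hD hD0.le⟩,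
    fun α hα => max_div_le_max_div_min h1 h2.le h3 h6 hα, fun h => ?_, fun h => ?_⟩
  · rw [max_eq_left (by linarith)]
  · rw [max_eq_right (by linarith)]
    field_simp
    ring
end
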